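/- Let P be a non-degenerate regular abstract polytope of rank n ≥ 3 of type {p_1, …, p_{n−1}}. Then the halving group H(P) has index exactly 2 in Aut(P) if and only if the facet graph of P — the graph whose vertices are the facets (faces of rank n−1) of P, with two facets adjacent when they are both incident to a common face of rank n−2 — is bipartite; in particular, this is possible only if p_{n−1} is even. -/

import Mathlib

set_option autoImplicit false

noncomputable section

/-! ### C-groups -/

/-- A family of involutions satisfying the intersection condition
(the family is a *C-group* for the group it generates). -/
def IsCGroup {G : Type*} [Group G] {I : Type*} (ρ : I → G) : Prop :=
  (∀ i, orderOf (ρ i) = 2) ∧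
    ∀ J K : Set I,
      Subgroup.closure (ρ '' J) ⊓ Subgroup.closure (ρ '' K) =
        Subgroup.closure (ρ '' (J ∩ K))

/-! ### Incidence systems -/

/-- The data of an incidence system over a type set `I`. -/
structure IncidenceSystem (I : Type*) where
  X : Type*
  t : X → I
  inc : X → X → Prop

namespace IncidenceSystem

variable {I : Type*} (Γ : IncidenceSystem I)

/-- The axioms of an incidence system: incidence is reflexive, symmetric and
two incident elements of the same type are equal. -/
def IsSystem : Prop :=
  (∀ x, Γ.inc x x) ∧ (∀ x y, Γ.inc x y → Γ.inc y x) ∧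
    ∀ x y, Γ.inc x y → Γ.t x = Γ.t y → x = y

/-- A flag: a set of pairwise incident elements. -/
def IsFlag (F : Set Γ.X) : Prop := ∀ x ∈ F, ∀ y ∈ F, Γ.inc x y

/-- A chamber: a flag whose type set is all of `I`. -/
def IsChamber (C : Set Γ.X) : Prop := Γ.IsFlag C ∧ Γ.t '' C = Set.univ

/-- An incidence geometry: every flag is contained in a chamber. -/
def IsGeometry : Prop :=
  Γ.IsSystem ∧ ∀ F : Set Γ.X, Γ.IsFlag F → ∃ C : Set Γ.X, Γ.IsChamber C ∧ F ⊆ C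

/-- The set of elements of the residue of the flag `F`. -/
def residueSet (F : Set Γ.X) : Set Γ.X := {x | x ∉ F ∧ ∀ y ∈ F, Γ.inc x y}

/-- Thin: every residue of rank one has exactly two elements. -/
def IsThin : Prop :=
  ∀ F : Set Γ.X, Γ.IsFlag F → (Set.univ \ Γ.t '' F).ncard = 1 →
    (Γ.residueSet F).ncard = 2

/-- Connectivity of the incidence graph restricted to a set `S`. -/
def ConnOn (S : Set Γ.X) : Prop :=
  ∀ x ∈ S, ∀ y ∈ S,
    Relation.ReflTransGen (fun a b => a ∈ S ∧ b ∈ S ∧ Γ.inc a b) x y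

/-- Connectivity of the incidence graph. -/
def IsConnected : Prop := Γ.ConnOn Set.univ

/-- Residual connectedness: connected and every residue of rank at least two
is connected. -/
def IsResiduallyConnected : Prop :=
  Γ.IsConnected ∧
    ∀ F : Set Γ.X, Γ.IsFlag F → 2 ≤ (Set.univ \ Γ.t '' F).ncard →
      Γ.ConnOn (Γ.residueSet F)

/-- A hypertope: a thin residually connected incidence geometry. -/
def IsHypertope : Prop := Γ.IsGeometry ∧ Γ.IsThin ∧ Γ.IsResiduallyConnected

/-- The group of type-preserving automorphisms. -/
def typeAut : Subgroup (Equiv.Perm Γ.X) where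
  carrier := {α | (∀ x, Γ.t (α x) = Γ.t x) ∧
    ∀ x y, Γ.inc (α x) (α y) ↔ Γ.inc x y}
  one_mem' := ⟨fun _ => rfl, fun _ _ => Iff.rfl⟩
  mul_mem' := by
    rintro a b ⟨ha1, ha2⟩ ⟨hb1, hb2⟩
    refine ⟨fun x => ?_, fun x y => ?_⟩
    · simp only [Equiv.Perm.mul_apply]; rw [ha1, hb1]
    · simp only [Equiv.Perm.mul_apply]; rw [ha2, hb2]
  inv_mem' := by
    rintro a ⟨ha1, ha2⟩
    refine ⟨fun x => ?_, fun x y => ?_⟩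
    · simpa using (ha1 (a⁻¹ x)).symm
    · simpa using (ha2 (a⁻¹ x) (a⁻¹ y)).symm

/-- Transitivity of the type-preserving automorphism group on chambers. -/
def ChamberTransitive : Prop :=
  ∀ C D : Set Γ.X, Γ.IsChamber C → Γ.IsChamber D →
    ∃ α ∈ Γ.typeAut, ⇑α '' C = D

/-- A regular hypertope: a chamber-transitive hypertope. -/
def IsRegularHypertope : Prop := Γ.IsHypertope ∧ Γ.ChamberTransitive

/-- Flag-transitivity: for each type set, the type-preserving automorphism group
is transitive on flags of that type. -/
def FlagTransitive : Prop :=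
  ∀ F G : Set Γ.X, Γ.IsFlag F → Γ.IsFlag G → Γ.t '' F = Γ.t '' G →
    ∃ α ∈ Γ.typeAut, ⇑α '' F = G

/-- `C'` is the chamber `i`-adjacent to the chamber `C`:  it is a chamber
differing from `C` exactly in its element of type `i`. -/
def IAdjacentChamber (C C' : Set Γ.X) (i : I) : Prop :=
  Γ.IsChamber C' ∧ C' ≠ C ∧ ∀ x ∈ C, Γ.t x ≠ i → x ∈ C'

/-- The stabiliser of a flag in the type-preserving automorphism group. -/
def flagStab (F : Set Γ.X) : Subgroup ↥Γ.typeAut where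
  carrier := {α | ∀ x ∈ F, (↑α : Equiv.Perm Γ.X) x = x}
  one_mem' := by intro x hx; simp
  mul_mem' := by
    intro a b ha hb x hx
    simp only [Subgroup.coe_mul, Equiv.Perm.mul_apply]
    rw [hb x hx, ha x hx]
  inv_mem' := by
    intro a ha x hx
    have h2 := congrArg (⇑(↑a : Equiv.Perm Γ.X)⁻¹) (ha x hx)
    simpa using h2.symm

end IncidenceSystem
/-! ### Coset incidence systems -/

/-- The right coset `H g`. -/
def rCoset {G : Type*} [Group G] (H : Subgroup G) (g : G) : Set G :=
  {x | x * g⁻¹ ∈ H}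

/-- The elements of the coset incidence system: right cosets of the `Gi`,
marked by their type. -/
abbrev cosetX {G : Type*} [Group G] {I : Type*} (Gi : I → Subgroup G) : Type _ :=
  Σ i : I, {s : Set G // ∃ g : G, s = rCoset (Gi i) g}

/-- The coset incidence system `Γ(G; (G_i)_{i ∈ I})`: the `i`-elements are the
right cosets of `G_i`, and two cosets are incident iff they meet. -/
def cosetSystem {G : Type*} [Group G] {I : Type*} (Gi : I → Subgroup G) :
    IncidenceSystem I where
  X := cosetX Gi
  t := fun x => x.1
  inc := fun x y => (x.2.1 ∩ y.2.1).Nonempty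

/-- Right multiplication by `g` on the cosets. -/
def cosetMul {G : Type*} [Group G] {I : Type*} (Gi : I → Subgroup G) (g : G) :
    cosetX Gi → cosetX Gi :=
  fun x => ⟨x.1, ⟨(· * g) '' x.2.1, by
    obtain ⟨s, g₀, hg₀⟩ := x.2
    refine ⟨g₀ * g, ?_⟩
    subst hg₀
    ext y
    simp only [Set.mem_image, rCoset, Set.mem_setOf_eq, mul_inv_rev]
    constructor
    · rintro ⟨z, hz, rfl⟩
      simpa [mul_assoc] using hz
    · intro hy
      exact ⟨y * g⁻¹, by simpa [mul_assoc] using hy, by simp⟩⟩⟩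
/-! ### Abstract polytopes -/

/-- A flag of a partially ordered set: a maximal chain. -/
def IsMaxFlag (P : Type*) [PartialOrder P] (F : Set P) : Prop :=
  IsMaxChain (· ≤ ·) F

/-- Strong flag-connectivity: any two flags `F`, `G` are joined by a sequence of
flags, each containing `F ∩ G`, in which consecutive flags differ in exactly
one face. -/
def StronglyFlagConnected (P : Type*) [PartialOrder P] : Prop :=
  ∀ F G : Set P, IsMaxFlag P F → IsMaxFlag P G →
    Relation.ReflTransGen
      (fun A B => IsMaxFlag P A ∧ IsMaxFlag P B ∧ F ∩ G ⊆ A ∧ F ∩ G ⊆ B ∧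
        (A \ B).ncard = 1 ∧ (B \ A).ncard = 1) F G

/-- An abstract polytope of rank `n`: a bounded poset, graded by the rank
function `rk` ranging from `-1` (the least face) to `n` (the greatest face),
each flag containing exactly one face of each rank (hence `n + 2` faces),
satisfying the diamond condition and strong flag-connectivity. -/
def IsPolytope (P : Type*) [PartialOrder P] (rk : P → ℤ) (n : ℕ) : Prop :=
  (∃ b : P, IsBot b ∧ rk b = -1) ∧
  (∃ tp : P, IsTop tp ∧ rk tp = n) ∧
  StrictMono rk ∧
  (∀ F : Set P, IsMaxFlag P F → ∀ k : ℤ, -1 ≤ k → k ≤ (n : ℤ) → ∃ x ∈ F, rk x = k) ∧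
  (∀ x z : P, x < z → rk z = rk x + 2 → {y : P | x < y ∧ y < z}.ncard = 2) ∧
  StronglyFlagConnected P

/-- Non-degenerate: every section of rank 2 is a `p`-gon with `p ≥ 3`,
i.e. has at least three faces of each intermediate rank. -/
def NonDegenerate (P : Type*) [PartialOrder P] (rk : P → ℤ) : Prop :=
  ∀ F G : P, F < G → rk G = rk F + 3 →
    ∃ H₁ H₂ H₃ : P,
      (F < H₁ ∧ H₁ < G ∧ rk H₁ = rk F + 1) ∧
      (F < H₂ ∧ H₂ < G ∧ rk H₂ = rk F + 1) ∧
      (F < H₃ ∧ H₃ < G ∧ rk H₃ = rk F + 1) ∧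
      H₁ ≠ H₂ ∧ H₁ ≠ H₃ ∧ H₂ ≠ H₃

/-- The group of order automorphisms of a poset (the automorphism group of an
abstract polytope). -/
def orderAut (P : Type*) [PartialOrder P] : Subgroup (Equiv.Perm P) where
  carrier := {α | ∀ x y : P, α x ≤ α y ↔ x ≤ y}
  one_mem' := fun _ _ => Iff.rfl
  mul_mem' := by
    intro a b ha hb x y
    simp only [Equiv.Perm.mul_apply]
    rw [ha, hb]
  inv_mem' := by
    intro a ha x y
    simpa using (ha (a⁻¹ x) (a⁻¹ y)).symm

/-- A regular polytope: the automorphism group is transitive on flags. -/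
def IsRegularPolytope (P : Type*) [PartialOrder P] : Prop :=
  ∀ F G : Set P, IsMaxFlag P F → IsMaxFlag P G →
    ∃ α ∈ orderAut P, ⇑α '' F = G

/-- `Φ` is a base flag and `ϱ` the corresponding family of distinguished
generators: `ϱ i` maps `Φ` to the flag `Φ^i` differing from `Φ` exactly in
its face of rank `i`. -/
def IsDistinguishedGens (P : Type*) [PartialOrder P] (rk : P → ℤ) (n : ℕ)
    (Φ : Set P) (ϱ : Fin n → ↥(orderAut P)) : Prop :=
  IsMaxFlag P Φ ∧
    ∀ i : Fin n,
      ⇑(ϱ i).1 '' Φ ≠ Φ ∧ ∀ x ∈ Φ, rk x ≠ (i : ℤ) → x ∈ ⇑(ϱ i).1 '' Φ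

/-- The incidence system associated with an abstract polytope: the elements are
the proper faces (the faces of ranks `0, …, n-1`), the type of a face is its
rank and incidence is comparability. -/
def polytopeSystem (P : Type*) [PartialOrder P] (rk : P → ℤ) (n : ℕ) :
    IncidenceSystem (Fin n) where
  X := {x : P // 0 ≤ rk x ∧ rk x < (n : ℤ)}
  t := fun x => ⟨(rk x.1).toNat, by
    have h1 := x.2.1; have h2 := x.2.2; omega⟩
  inc := fun x y => x.1 ≤ y.1 ∨ y.1 ≤ x.1

/-! ### The halving operation -/

/-- The halving generators: `ρ i = ϱ i` for `i ≤ n - 2` and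
`ρ (n-1) = ϱ (n-1) * ϱ (n-2) * ϱ (n-1)`. -/
def halvingGens {G : Type*} [Group G] (n : ℕ) (ϱ : Fin n → G) : Fin n → G :=
  fun i =>
    if (i : ℕ) = n - 1 then
      ϱ i * ϱ (⟨n - 2, by have := i.isLt; omega⟩ : Fin n) * ϱ i
    else ϱ i

/-- The lift of a generating family into the subgroup it generates. -/
def liftGens {G : Type*} [Group G] {I : Type*} (ρ : I → G) :
    I → ↥(Subgroup.closure (Set.range ρ)) :=
  fun i => ⟨ρ i, Subgroup.subset_closure (Set.mem_range_self i)⟩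

/-- The subgroups `H_i = ⟨ρ_j : j ≠ i⟩` of the halving group `H(P)`,
where `ρ` is the family of halving generators obtained from `ϱ`. -/
def halvingCosetFamily {G : Type*} [Group G] (n : ℕ) (ϱ : Fin n → G) :
    Fin n → Subgroup ↥(Subgroup.closure (Set.range (halvingGens n ϱ))) :=
  fun i => Subgroup.closure (liftGens (halvingGens n ϱ) '' {j | j ≠ i})

/-- The coset incidence system `Γ(H(P); (H_i))` of the halving group. -/
def halvingCosetSystem {G : Type*} [Group G] (n : ℕ) (ϱ : Fin n → G) :
    IncidenceSystem (Fin n) :=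
  cosetSystem (halvingCosetFamily n ϱ)
/-! ### Generalised cubes -/

/-- The vertex set of a polytope: the faces of rank `0`. -/
abbrev polyVertices (K : Type*) (rk : K → ℤ) : Type _ := {v : K // rk v = 0}

/-- The face `F(x)` of the generalised cube `2^K`:
`F(x) = {y : y_v = x_v whenever the vertex v is not incident to F}`. -/
def cubeFace (K : Type*) [PartialOrder K] (rk : K → ℤ) (F : K)
    (x : polyVertices K rk → Bool) : Set (polyVertices K rk → Bool) :=
  {y | ∀ v : polyVertices K rk, ¬ v.1 ≤ F → y v = x v}

/-- Danzer's generalised cube `2^K`: the improper least face `∅` together with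
the sets `F(x)` for `F` a face of `K` (for `F` the least face of `K` this
gives the singletons `{x}`, the vertices of `2^K`; the faces of rank `i ≥ 1`
are the `F(x)` with `rk F = i - 1 ≥ 0`), ordered by inclusion. -/
abbrev genCube (K : Type*) [PartialOrder K] (rk : K → ℤ) : Type _ :=
  {S : Set (polyVertices K rk → Bool) //
    S = ∅ ∨ ∃ (F : K) (x : polyVertices K rk → Bool), S = cubeFace K rk F x}

/-- The rank function of the dual of a polytope of rank `n`. -/
def dualRk {P : Type*} (rk : P → ℤ) (n : ℕ) : Pᵒᵈ → ℤ :=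
  fun x => (n : ℤ) - 1 - rk (OrderDual.ofDual x)

/-- `D2 K rk n`, for `K` a polytope of rank `n`, is the polytope
`D2K = (2^{K*})*`, the dual of the generalised cube over the dual of `K`. -/
abbrev D2 (K : Type*) [PartialOrder K] (rkK : K → ℤ) (n : ℕ) : Type _ :=
  (genCube Kᵒᵈ (dualRk rkK n))ᵒᵈ

/-- The facet graph of a rank-`n` polytope is bipartite: the facets (faces of
rank `n-1`) can be 2-coloured so that distinct facets sharing a face of rank
`n-2` get different colours. -/
def FacetGraphBipartite (P : Type*) [PartialOrder P] (rk : P → ℤ) (n : ℕ) : Prop :=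
  ∃ c : P → Bool, ∀ F F' : P, rk F = (n : ℤ) - 1 → rk F' = (n : ℤ) - 1 → F ≠ F' →
    (∃ E : P, rk E = (n : ℤ) - 2 ∧ E ≤ F ∧ E ≤ F') → c F ≠ c F'

/-! ### Flags of a polytope -/

section Flags

variable {P : Type*} [PartialOrder P] {rk : P → ℤ} {n : ℕ}

theorem IsPolytope.strictMono (hP : IsPolytope P rk n) : StrictMono rk := hP.2.2.1

theorem IsPolytope.neg_one_le_rk (hP : IsPolytope P rk n) (x : P) : -1 ≤ rk x := by
  obtain ⟨b, hb, hrb⟩ := hP.1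
  rw [← hrb]
  exact hP.strictMono.monotone (hb x)

theorem IsPolytope.rk_le (hP : IsPolytope P rk n) (x : P) : rk x ≤ n := by
  obtain ⟨t, ht, hrt⟩ := hP.2.1
  rw [← hrt]
  exact hP.strictMono.monotone (ht x)

theorem IsPolytope.eq_of_rk_eq_neg_one (hP : IsPolytope P rk n) {x y : P}
    (hx : rk x = -1) (hy : rk y = -1) : x = y := by
  obtain ⟨b, hb, hrb⟩ := hP.1
  have key : ∀ z, rk z = -1 → b = z := fun z hz =>
    (hb z).eq_or_lt.resolve_right fun h => by
      have := hP.strictMono h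
      omega
  rw [← key x hx, key y hy]

theorem IsPolytope.eq_of_rk_eq_rank (hP : IsPolytope P rk n) {x y : P}
    (hx : rk x = n) (hy : rk y = n) : x = y := by
  obtain ⟨t, ht, hrt⟩ := hP.2.1
  have key : ∀ z, rk z = n → z = t := fun z hz =>
    (ht z).eq_or_lt.resolve_right fun h => by
      have := hP.strictMono h
      omega
  rw [key x hx, key y hy]

/-- In a flag, faces are ordered by their ranks. -/
theorem IsMaxFlag.lt_of_rk_lt (hP : IsPolytope P rk n) {A : Set P} (hA : IsMaxFlag P A)
    {x y : P} (hx : x ∈ A) (hy : y ∈ A) (h : rk x < rk y) : x < y := by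
  rcases hA.1.total hx hy with hxy | hxy
  · exact lt_of_le_of_ne hxy (by rintro rfl; exact h.false)
  · exact absurd (hP.strictMono.monotone hxy) (not_le.2 h)

theorem IsMaxFlag.eq_of_rk_eq (hP : IsPolytope P rk n) {A : Set P} (hA : IsMaxFlag P A)
    {x y : P} (hx : x ∈ A) (hy : y ∈ A) (h : rk x = rk y) : x = y := by
  rcases hA.1.total hx hy with hxy | hxy
  · exact hxy.eq_or_lt.resolve_right fun hlt => (hP.strictMono hlt).ne h
  · exact (hxy.eq_or_lt.resolve_right fun hlt => (hP.strictMono hlt).ne' h).symm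

theorem IsMaxFlag.exists_rk_eq (hP : IsPolytope P rk n) {A : Set P} (hA : IsMaxFlag P A)
    {k : ℤ} (h₁ : -1 ≤ k) (h₂ : k ≤ n) : ∃ x ∈ A, rk x = k :=
  hP.2.2.2.1 A hA k h₁ h₂

theorem IsMaxFlag.eq_of_subset {A B : Set P} (hA : IsMaxFlag P A) (hB : IsMaxFlag P B)
    (h : A ⊆ B) : A = B :=
  hA.2 hB.1 h

theorem exists_isMaxFlag_of_le {x y : P} (h : x ≤ y) :
    ∃ A : Set P, IsMaxFlag P A ∧ x ∈ A ∧ y ∈ A := by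
  have hc : IsChain (· ≤ ·) ({x, y} : Set P) := by
    rintro a (rfl | rfl) b (rfl | rfl) hab <;> simp_all
  obtain ⟨A, hA, hsub⟩ := hc.exists_maxChain
  exact ⟨A, hA, hsub (by simp), hsub (by simp)⟩

/-- The flags `A` and `B` agree except possibly in rank `i`. -/
def AgreeOff (rk : P → ℤ) (i : ℤ) (A B : Set P) : Prop :=
  ∀ x ∈ A, rk x ≠ i → x ∈ B

theorem AgreeOff.symm (hP : IsPolytope P rk n) {i : ℤ} {A B : Set P}
    (hA : IsMaxFlag P A) (hB : IsMaxFlag P B) (h : AgreeOff rk i A B) :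
    AgreeOff rk i B A := by
  intro y hy hyi
  obtain ⟨x, hx, hxy⟩ := hA.exists_rk_eq hP (hP.neg_one_le_rk y) (hP.rk_le y)
  rwa [← hB.eq_of_rk_eq hP (h x hx (hxy ▸ hyi)) hy hxy]

/-- The diamond condition for three faces. -/
theorem IsPolytope.eq_of_diamond (hP : IsPolytope P rk n) {x z a b c : P} (hxz : rk z = rk x + 2)
    (ha : x < a ∧ a < z) (hb : x < b ∧ b < z) (hc : x < c ∧ c < z) (hba : b ≠ a) (hca : c ≠ a) :
    b = c := by
  have hcard := hP.2.2.2.2.1 x z (ha.1.trans ha.2) hxz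
  obtain ⟨u, v, -, huv⟩ := Set.ncard_eq_two.1 hcard
  have key : ∀ y, x < y ∧ y < z → y = u ∨ y = v := fun y hy => by
    have : y ∈ {y : P | x < y ∧ y < z} := hy
    simpa [huv] using this
  grind

/-- A flag has at most one other flag agreeing with it off rank `i`. -/
theorem IsPolytope.flag_eq_of_agreeOff (hP : IsPolytope P rk n) {i : ℤ} (hi₀ : 0 ≤ i) (hin : i < n)
    {A B C : Set P} (hA : IsMaxFlag P A) (hB : IsMaxFlag P B) (hC : IsMaxFlag P C)
    (hAB : AgreeOff rk i A B) (hAC : AgreeOff rk i A C) (hBA : B ≠ A) (hCA : C ≠ A) :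
    B = C := by
  obtain ⟨x, hx, hrx⟩ := hA.exists_rk_eq hP (k := i - 1) (by omega) (by omega)
  obtain ⟨z, hz, hrz⟩ := hA.exists_rk_eq hP (k := i + 1) (by omega) (by omega)
  obtain ⟨a, ha, hra⟩ := hA.exists_rk_eq hP (k := i) (by omega) (by omega)
  obtain ⟨b, hb, hrb⟩ := hB.exists_rk_eq hP (k := i) (by omega) (by omega)
  obtain ⟨c, hc, hrc⟩ := hC.exists_rk_eq hP (k := i) (by omega) (by omega)
  have between : ∀ {D : Set P} {d : P}, IsMaxFlag P D → AgreeOff rk i A D → d ∈ D → rk d = i →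
      x < d ∧ d < z := fun hD hAD hd hrd =>
    ⟨hD.lt_of_rk_lt hP (hAD x hx (by omega)) hd (by omega),
      hD.lt_of_rk_lt hP hd (hAD z hz (by omega)) (by omega)⟩
  have ne : ∀ {D : Set P} {d : P}, IsMaxFlag P D → AgreeOff rk i A D → d ∈ D → rk d = i →
      D ≠ A → d ≠ a := by
    rintro D d hD hAD hd hrd hDA rfl
    refine hDA (hA.eq_of_subset hD fun y hy => ?_).symm
    by_cases hyi : rk y = i
    · rwa [hA.eq_of_rk_eq hP hy ha (hyi.trans hrd.symm)]
    · exact hAD y hy hyi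
  have hbc : b = c := hP.eq_of_diamond (by omega) (between hA (fun y hy _ => hy) ha hra)
    (between hB hAB hb hrb) (between hC hAC hc hrc) (ne hB hAB hb hrb hBA) (ne hC hAC hc hrc hCA)
  refine hB.eq_of_subset hC fun y hy => ?_
  by_cases hyi : rk y = i
  · rwa [hB.eq_of_rk_eq hP hy hb (hyi.trans hrb.symm), hbc]
  · exact hAC y (hAB.symm hP hA hB y hy hyi) hyi

/-- Two flags differing in exactly one face agree off some proper rank, and no common face of the
two flags has that rank. -/
theorem IsPolytope.exists_agreeOff (hP : IsPolytope P rk n) {A B : Set P} (hA : IsMaxFlag P A)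
    (hB : IsMaxFlag P B) (h : (A \ B).ncard = 1) :
    B ≠ A ∧ ∃ i : Fin n, AgreeOff rk i A B ∧ ∀ x ∈ A ∩ B, rk x ≠ i := by
  obtain ⟨a, ha⟩ := Set.ncard_eq_one.1 h
  have haA : a ∈ A \ B := ha ▸ Set.mem_singleton a
  have h₁ : rk a ≠ -1 := fun h' => by
    obtain ⟨b, hb, hrb⟩ := hB.exists_rk_eq hP (k := -1) le_rfl (by omega)
    exact haA.2 (hP.eq_of_rk_eq_neg_one h' hrb ▸ hb)
  have h₂ : rk a ≠ n := fun h' => by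
    obtain ⟨b, hb, hrb⟩ := hB.exists_rk_eq hP (k := n) (by omega) le_rfl
    exact haA.2 (hP.eq_of_rk_eq_rank h' hrb ▸ hb)
  have h₃ := hP.neg_one_le_rk a
  have h₄ := hP.rk_le a
  refine ⟨by rintro rfl; exact haA.2 haA.1, ⟨(rk a).toNat, by omega⟩, ?_, ?_⟩
  · intro x hx hxa
    by_contra hxB
    have : x ∈ A \ B := ⟨hx, hxB⟩
    rw [ha] at this
    obtain rfl : x = a := this
    simp only [ne_eq] at hxa
    omega
  · intro x hx hxa
    simp only at hxa
    exact haA.2 (hA.eq_of_rk_eq hP hx.1 haA.1 (by omega) ▸ hx.2)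

/-! ### Automorphisms of a polytope -/

theorem orderAut_lt_iff (α : orderAut P) {x y : P} : α.1 x < α.1 y ↔ x < y := by
  simp only [lt_iff_le_not_ge, α.2 x y, α.2 y x]

/-- Automorphisms preserve ranks. -/
theorem IsPolytope.rk_orderAut (hP : IsPolytope P rk n) (α : orderAut P) (x : P) :
    rk (α.1 x) = rk x := by
  have key : ∀ (k : ℕ) (β : orderAut P) (y : P), rk y = k - 1 → rk y ≤ rk (β.1 y) := by
    intro k
    induction k with
    | zero =>
      intro β y hy
      have := hP.neg_one_le_rk (β.1 y)
      omega
    | succ k ih =>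
      intro β y hy
      obtain ⟨A, hA, hyA, -⟩ := exists_isMaxFlag_of_le (le_refl y)
      have := hP.rk_le y
      obtain ⟨z, hz, hrz⟩ := hA.exists_rk_eq hP (k := k - 1) (by omega) (by omega)
      have h₁ := ih β z hrz
      have h₂ := hP.strictMono
        ((orderAut_lt_iff β).2 (hA.lt_of_rk_lt hP hz hyA (by omega)))
      omega
  have key' : ∀ (β : orderAut P) (y : P), rk y ≤ rk (β.1 y) := fun β y => by
    have := hP.neg_one_le_rk y
    exact key (rk y + 1).toNat β y (by omega)
  refine le_antisymm ?_ (key' α x)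
  simpa using key' α⁻¹ (α.1 x)

theorem IsMaxFlag.image (α : orderAut P) {A : Set P} (hA : IsMaxFlag P A) :
    IsMaxFlag P (α.1 '' A) := by
  have chain : ∀ (β : orderAut P) (B : Set P), IsChain (· ≤ ·) B → IsChain (· ≤ ·) (β.1 '' B) := by
    rintro β B hB _ ⟨x, hx, rfl⟩ _ ⟨y, hy, rfl⟩ -
    simpa only [β.2 x y, β.2 y x] using hB.total hx hy
  refine ⟨chain α A hA.1, fun B hB hAB => ?_⟩
  have h := hA.2 (chain α⁻¹ B hB) (fun x hx => ⟨α.1 x, hAB ⟨x, hx, rfl⟩, by simp⟩)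
  rw [h]
  ext x
  simp

theorem AgreeOff.image (hP : IsPolytope P rk n) (α : orderAut P) {i : ℤ} {A B : Set P}
    (h : AgreeOff rk i A B) : AgreeOff rk i (α.1 '' A) (α.1 '' B) := by
  rintro _ ⟨x, hx, rfl⟩ hxi
  rw [hP.rk_orderAut] at hxi
  exact ⟨x, h x hx hxi, rfl⟩

theorem orderAut_image_mul (α β : orderAut P) (A : Set P) :
    (α * β).1 '' A = α.1 '' (β.1 '' A) := by
  simp [Set.image_image]

theorem orderAut_image_ne (α : orderAut P) {A B : Set P} (h : A ≠ B) :
    α.1 '' A ≠ α.1 '' B :=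
  fun h' => h (α.1.injective.image_injective h')

/-- Automorphisms act freely on flags. -/
theorem IsPolytope.eq_one_of_image_eq (hP : IsPolytope P rk n) {Φ : Set P} (hΦ : IsMaxFlag P Φ)
    {α : orderAut P} (hα : α.1 '' Φ = Φ) : α = 1 := by
  have key : ∀ A : Set P, IsMaxFlag P A → α.1 '' A = A := by
    intro A hA
    refine (hP.2.2.2.2.2 Φ A hΦ hA).head_induction_on
      (motive := fun B _ => α.1 '' B = B → α.1 '' A = A) ?_ ?_ hα
    · exact id
    · rintro B C ⟨hB, hC, -, -, hBC, -⟩ - ih hαB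
      apply ih
      obtain ⟨hne, i, hi, -⟩ := hP.exists_agreeOff hB hC hBC
      refine hP.flag_eq_of_agreeOff (by omega) (by exact_mod_cast i.2) hB (hC.image α) hC ?_ hi ?_ hne
      · have := hi.image hP α
        rwa [hαB] at this
      · have := orderAut_image_ne α hne
        rwa [hαB] at this
  apply Subtype.ext
  ext x
  obtain ⟨A, hA, hx, -⟩ := exists_isMaxFlag_of_le (le_refl x)
  exact hA.eq_of_rk_eq hP (key A hA ▸ Set.mem_image_of_mem _ hx) hx (hP.rk_orderAut α x)

theorem IsPolytope.eq_of_image_eq (hP : IsPolytope P rk n) {Φ : Set P} (hΦ : IsMaxFlag P Φ)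
    {α β : orderAut P} (h : α.1 '' Φ = β.1 '' Φ) : α = β := by
  have : (β⁻¹ * α).1 '' Φ = Φ := by
    rw [orderAut_image_mul, h, ← orderAut_image_mul]
    simp
  exact (inv_mul_eq_one.1 (hP.eq_one_of_image_eq hΦ this)).symm

/-! ### Distinguished generators -/

variable {Φ : Set P} {ϱ : Fin n → orderAut P}

theorem IsDistinguishedGens.apply_eq (hP : IsPolytope P rk n)
    (hϱ : IsDistinguishedGens P rk n Φ ϱ) {i : Fin n} {x : P} (hx : x ∈ Φ) (hxi : rk x ≠ i) :
    (ϱ i).1 x = x :=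
  (hϱ.1.image (ϱ i)).eq_of_rk_eq hP (Set.mem_image_of_mem _ hx) ((hϱ.2 i).2 x hx hxi)
    (hP.rk_orderAut _ _)

theorem IsDistinguishedGens.apply_ne (hP : IsPolytope P rk n)
    (hϱ : IsDistinguishedGens P rk n Φ ϱ) {i : Fin n} {x : P} (hx : x ∈ Φ) (hxi : rk x = i) :
    (ϱ i).1 x ≠ x := by
  intro h
  refine (hϱ.2 i).1 (hϱ.1.eq_of_subset (hϱ.1.image (ϱ i)) fun y hy => ?_).symm
  by_cases hyi : rk y = i
  · rw [hϱ.1.eq_of_rk_eq hP hy hx (hyi.trans hxi.symm)]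
    exact ⟨x, hx, h⟩
  · exact (hϱ.2 i).2 y hy hyi

theorem IsDistinguishedGens.image_eq (hP : IsPolytope P rk n)
    (hϱ : IsDistinguishedGens P rk n Φ ϱ) {i : Fin n} {A : Set P} (hA : IsMaxFlag P A)
    (h : AgreeOff rk i Φ A) (hne : A ≠ Φ) : (ϱ i).1 '' Φ = A :=
  hP.flag_eq_of_agreeOff (by omega) (by exact_mod_cast i.2) hϱ.1 (hϱ.1.image _) hA
    (hϱ.2 i).2 h (hϱ.2 i).1 hne

theorem IsDistinguishedGens.mul_self (hP : IsPolytope P rk n)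
    (hϱ : IsDistinguishedGens P rk n Φ ϱ) (i : Fin n) : ϱ i * ϱ i = 1 := by
  have key : (ϱ i)⁻¹.1 '' Φ = (ϱ i).1 '' Φ := by
    have hinv : (ϱ i)⁻¹.1 '' ((ϱ i).1 '' Φ) = Φ := by
      rw [← orderAut_image_mul]; simp
    refine (hϱ.image_eq hP (hϱ.1.image _) ?_ ?_).symm
    · have hΦ : AgreeOff rk i Φ ((ϱ i).1 '' Φ) := (hϱ.2 i).2
      have := (hΦ.symm hP hϱ.1 (hϱ.1.image _)).image hP (ϱ i)⁻¹
      rwa [hinv] at this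
    · have := orderAut_image_ne (ϱ i)⁻¹ (hϱ.2 i).1.symm
      rwa [hinv] at this
  exact inv_eq_iff_mul_eq_one.1 (hP.eq_of_image_eq hϱ.1 key)

/-- An automorphism `α` is a product of those distinguished generators whose ranks are not the rank
of a common face of the base flag and its image under `α`. -/
theorem IsDistinguishedGens.mem_closure (hP : IsPolytope P rk n)
    (hϱ : IsDistinguishedGens P rk n Φ ϱ) (α : orderAut P) :
    α ∈ Subgroup.closure (ϱ '' {i | ∀ x ∈ Φ ∩ α.1 '' Φ, rk x ≠ i}) := by
  set K := Subgroup.closure (ϱ '' {i | ∀ x ∈ Φ ∩ α.1 '' Φ, rk x ≠ i})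
  suffices h : ∃ β ∈ K, β.1 '' Φ = α.1 '' Φ by
    obtain ⟨β, hβ, h⟩ := h
    rwa [← hP.eq_of_image_eq hϱ.1 h]
  refine (hP.2.2.2.2.2 Φ (α.1 '' Φ) hϱ.1 (hϱ.1.image α)).rec
    (motive := fun A _ => ∃ β ∈ K, β.1 '' Φ = A) ⟨1, K.one_mem, by simp⟩ ?_
  rintro A B - ⟨hA, hB, hSA, hSB, hAB, -⟩ ⟨β, hβ, rfl⟩
  obtain ⟨hne, i, hi, hcommon⟩ := hP.exists_agreeOff hA hB hAB
  have hinv : ∀ C : Set P, β⁻¹.1 '' (β.1 '' C) = C := fun C => by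
    rw [← orderAut_image_mul]; simp
  refine ⟨β * ϱ i, K.mul_mem hβ (Subgroup.subset_closure
    ⟨i, fun x hx => hcommon x ⟨hSA hx, hSB hx⟩, rfl⟩), ?_⟩
  have : (ϱ i).1 '' Φ = β⁻¹.1 '' B := by
    refine hϱ.image_eq hP (hB.image _) ?_ ?_
    · have := hi.image hP β⁻¹
      rwa [hinv] at this
    · have := orderAut_image_ne β⁻¹ hne
      rwa [hinv] at this
  rw [orderAut_image_mul, this, ← orderAut_image_mul]
  simp

theorem IsDistinguishedGens.closure_range (hP : IsPolytope P rk n)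
    (hϱ : IsDistinguishedGens P rk n Φ ϱ) : Subgroup.closure (Set.range ϱ) = ⊤ :=
  (Subgroup.eq_top_iff' _).2 fun α =>
    Subgroup.closure_mono (Set.image_subset_range _ _) (hϱ.mem_closure hP α)

/-! ### The halving group -/

theorem halvingGens_of_ne {G : Type*} [Group G] (ϱ : Fin n → G) {i : Fin n}
    (hi : (i : ℕ) ≠ n - 1) : halvingGens n ϱ i = ϱ i :=
  if_neg hi

theorem mem_halving_of_ne {G : Type*} [Group G] (ϱ : Fin n → G) {i : Fin n}
    (hi : (i : ℕ) ≠ n - 1) : ϱ i ∈ Subgroup.closure (Set.range (halvingGens n ϱ)) :=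
  Subgroup.subset_closure ⟨i, halvingGens_of_ne ϱ hi⟩

/-- The stabiliser of the base facet is contained in the halving group. -/
theorem IsDistinguishedGens.mem_halving_of_apply_eq (hP : IsPolytope P rk n)
    (hϱ : IsDistinguishedGens P rk n Φ ϱ) {F : P} (hF : F ∈ Φ) (hrF : rk F = (n : ℤ) - 1)
    {α : orderAut P} (hα : α.1 F = F) :
    α ∈ Subgroup.closure (Set.range (halvingGens n ϱ)) := by
  refine (Subgroup.closure_le _).2 ?_ (hϱ.mem_closure hP α)
  rintro _ ⟨i, hi, rfl⟩
  refine mem_halving_of_ne ϱ fun hin => ?_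
  have := hi F ⟨hF, F, hF, hα⟩
  have := i.2
  omega

/-- Two facets distinct from a third one and sharing a ridge with it are equal. -/
theorem IsPolytope.facet_eq_of_ridge_le (hP : IsPolytope P rk n) {E F F₁ F₂ : P}
    (hrE : rk E = (n : ℤ) - 2) (hrF : rk F = (n : ℤ) - 1) (hrF₁ : rk F₁ = (n : ℤ) - 1)
    (hrF₂ : rk F₂ = (n : ℤ) - 1) (hE : E ≤ F) (hE₁ : E ≤ F₁) (hE₂ : E ≤ F₂) (h₁ : F₁ ≠ F)
    (h₂ : F₂ ≠ F) : F₁ = F₂ := by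
  obtain ⟨t, ht, hrt⟩ := hP.2.1
  have between : ∀ D, rk D = (n : ℤ) - 1 → E ≤ D → E < D ∧ D < t := fun D hD hED =>
    ⟨lt_of_le_of_ne hED (by rintro rfl; omega), lt_of_le_of_ne (ht D) (by rintro rfl; omega)⟩
  exact hP.eq_of_diamond (by omega) (between F hrF hE) (between F₁ hrF₁ hE₁)
    (between F₂ hrF₂ hE₂) h₁ h₂

/-- The last distinguished generator conjugates the others into the halving group. -/
theorem IsDistinguishedGens.conj_mem_halving (hn : 2 ≤ n) (hP : IsPolytope P rk n)
    (hϱ : IsDistinguishedGens P rk n Φ ϱ) {i : Fin n} (hi : (i : ℕ) ≠ n - 1) :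
    ϱ ⟨n - 1, by omega⟩ * ϱ i * ϱ ⟨n - 1, by omega⟩ ∈
      Subgroup.closure (Set.range (halvingGens n ϱ)) := by
  by_cases hi' : (i : ℕ) = n - 2
  · rw [show i = ⟨n - 2, by omega⟩ from Fin.ext hi']
    exact Subgroup.subset_closure ⟨⟨n - 1, by omega⟩, if_pos rfl⟩
  obtain ⟨F, hF, hrF⟩ := hϱ.1.exists_rk_eq hP (k := (n : ℤ) - 1) (by omega) (by omega)
  obtain ⟨E, hE, hrE⟩ := hϱ.1.exists_rk_eq hP (k := (n : ℤ) - 2) (by omega) (by omega)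
  have hEF : E ≤ F := (hϱ.1.lt_of_rk_lt hP hE hF (by omega)).le
  apply hϱ.mem_halving_of_apply_eq hP hF hrF
  set r := ϱ ⟨n - 1, by omega⟩
  have hrr : ∀ x, r.1 (r.1 x) = x := fun x => by
    have := congrArg (fun β : orderAut P => β.1 x) (hϱ.mul_self hP ⟨n - 1, by omega⟩)
    simpa using this
  have hrE' : r.1 E = E := hϱ.apply_eq hP hE (by simp only [ne_eq]; omega)
  have hrF' : r.1 F ≠ F := hϱ.apply_ne hP hF (by simp only; omega)
  have hiE : (ϱ i).1 E = E := hϱ.apply_eq hP hE (by omega)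
  have hiF : (ϱ i).1 F = F := hϱ.apply_eq hP hF (by omega)
  have hErF : E ≤ r.1 F := by rw [← hrE']; exact (r.2 E F).2 hEF
  have key : (ϱ i).1 (r.1 F) = r.1 F := by
    refine hP.facet_eq_of_ridge_le hrE hrF ?_ ?_ hEF ?_ hErF ?_ hrF'
    · simpa only [hP.rk_orderAut] using hrF
    · simpa only [hP.rk_orderAut] using hrF
    · rw [← hiE]; exact ((ϱ i).2 _ _).2 hErF
    · intro h
      exact hrF' ((ϱ i).1.injective (h.trans hiF.symm))
  change r.1 ((ϱ i).1 (r.1 F)) = F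
  rw [key, hrr]

/-- The halving group and its coset by the last distinguished generator cover the group. -/
theorem IsDistinguishedGens.mem_halving_or (hn : 2 ≤ n) (hP : IsPolytope P rk n)
    (hϱ : IsDistinguishedGens P rk n Φ ϱ) (α : orderAut P) :
    α ∈ Subgroup.closure (Set.range (halvingGens n ϱ)) ∨
      α * ϱ ⟨n - 1, by omega⟩ ∈ Subgroup.closure (Set.range (halvingGens n ϱ)) := by
  set H := Subgroup.closure (Set.range (halvingGens n ϱ))
  have hrr := hϱ.mul_self hP ⟨n - 1, by omega⟩
  have step : ∀ (β : orderAut P) (i : Fin n), (β ∈ H ∨ β * ϱ ⟨n - 1, by omega⟩ ∈ H) →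
      (β * ϱ i ∈ H ∨ β * ϱ i * ϱ ⟨n - 1, by omega⟩ ∈ H) := by
    intro β i hβ
    by_cases hi : (i : ℕ) = n - 1
    · rw [show i = ⟨n - 1, by omega⟩ from Fin.ext hi]
      rw [mul_assoc β, hrr, mul_one]
      exact hβ.symm
    · refine hβ.imp (fun h => H.mul_mem h (mem_halving_of_ne ϱ hi)) fun h => ?_
      have := H.mul_mem h (hϱ.conj_mem_halving hn hP hi)
      rw [mul_assoc, ← mul_assoc, ← mul_assoc, ← mul_assoc, mul_assoc β, hrr, mul_one] at this
      exact this
  have hα : α ∈ Subgroup.closure (Set.range ϱ) := hϱ.closure_range hP ▸ Subgroup.mem_top α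
  induction hα using Subgroup.closure_induction_right with
  | one => exact Or.inl H.one_mem
  | mul_right β _ γ hγ ih =>
    obtain ⟨i, rfl⟩ := hγ
    exact step β i ih
  | mul_inv_cancel β _ γ hγ ih =>
    obtain ⟨i, rfl⟩ := hγ
    rw [inv_eq_of_mul_eq_one_left (hϱ.mul_self hP i)]
    exact step β i ih

theorem IsDistinguishedGens.index_halving_eq_two_iff (hn : 2 ≤ n) (hP : IsPolytope P rk n)
    (hϱ : IsDistinguishedGens P rk n Φ ϱ) :
    (Subgroup.closure (Set.range (halvingGens n ϱ))).index = 2 ↔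
      ϱ ⟨n - 1, by omega⟩ ∉ Subgroup.closure (Set.range (halvingGens n ϱ)) := by
  set H := Subgroup.closure (Set.range (halvingGens n ϱ))
  constructor
  · intro hindex hr
    have htop : H = ⊤ := by
      rw [eq_top_iff, ← hϱ.closure_range hP, Subgroup.closure_le]
      rintro _ ⟨i, rfl⟩
      by_cases hi : (i : ℕ) = n - 1
      · rw [show i = ⟨n - 1, by omega⟩ from Fin.ext hi]
        exact hr
      · exact mem_halving_of_ne ϱ hi
    rw [htop, Subgroup.index_top] at hindex
    omega
  · intro hr
    refine Subgroup.index_eq_two_iff.2 ⟨ϱ ⟨n - 1, by omega⟩, fun β => ?_⟩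
    rcases hϱ.mem_halving_or hn hP β with h | h
    · exact Or.inr ⟨h, fun h' => hr ((H.mul_mem_cancel_left h).1 h')⟩
    · exact Or.inl ⟨h, fun h' => hr ((H.mul_mem_cancel_left h').1 h)⟩

/-- If the facet graph is bipartite, the last distinguished generator is not in the halving
group. -/
theorem IsDistinguishedGens.notMem_halving_of_bipartite (hn : 2 ≤ n) (hP : IsPolytope P rk n)
    (hϱ : IsDistinguishedGens P rk n Φ ϱ) (hb : FacetGraphBipartite P rk n) :
    ϱ ⟨n - 1, by omega⟩ ∉ Subgroup.closure (Set.range (halvingGens n ϱ)) := by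
  obtain ⟨c, hc⟩ := hb
  obtain ⟨F, hF, hrF⟩ := hϱ.1.exists_rk_eq hP (k := (n : ℤ) - 1) (by omega) (by omega)
  obtain ⟨E, hE, hrE⟩ := hϱ.1.exists_rk_eq hP (k := (n : ℤ) - 2) (by omega) (by omega)
  have hEF : E ≤ F := (hϱ.1.lt_of_rk_lt hP hE hF (by omega)).le
  set r := ϱ ⟨n - 1, by omega⟩
  have hrE' : r.1 E = E := hϱ.apply_eq hP hE (by simp only [ne_eq]; omega)
  have hrF' : r.1 F ≠ F := hϱ.apply_ne hP hF (by simp only; omega)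
  have hflip : ∀ α : orderAut P, c ((α * r).1 F) ≠ c (α.1 F) := fun α => by
    refine hc _ _ ?_ ?_ (fun h => hrF' (α.1.injective h)) ⟨α.1 E, ?_, ?_, ?_⟩
    · rwa [hP.rk_orderAut]
    · rwa [hP.rk_orderAut]
    · rwa [hP.rk_orderAut]
    · change α.1 E ≤ α.1 (r.1 F)
      rw [α.2, ← hrE', r.2]
      exact hEF
    · exact (α.2 _ _).2 hEF
  have hfix : ∀ (α : orderAut P) (i : Fin n), (i : ℕ) ≠ n - 1 →
      c ((α * ϱ i).1 F) = c (α.1 F) := fun α i hi => by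
    change c (α.1 ((ϱ i).1 F)) = _
    rw [hϱ.apply_eq hP hF (by omega)]
  have hgen : ∀ (α : orderAut P) (i : Fin n),
      c ((α * halvingGens n ϱ i).1 F) = c (α.1 F) := fun α i => by
    by_cases hi : (i : ℕ) = n - 1
    · rw [show i = ⟨n - 1, by omega⟩ from Fin.ext hi]
      have h₁ := hflip (α * r * ϱ ⟨n - 2, by omega⟩)
      have h₂ := hfix (α * r) ⟨n - 2, by omega⟩ (by simp only [ne_eq]; omega)
      have h₃ := hflip α
      rw [halvingGens, if_pos rfl, ← mul_assoc, ← mul_assoc]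
      rw [h₂] at h₁
      exact (Bool.eq_not_of_ne h₁).trans (Bool.eq_not_of_ne h₃.symm).symm
    · rw [halvingGens_of_ne ϱ hi]
      exact hfix α i hi
  have hmem : ∀ α ∈ Subgroup.closure (Set.range (halvingGens n ϱ)), c (α.1 F) = c F := by
    intro α hα
    induction hα using Subgroup.closure_induction_right with
    | one => rfl
    | mul_right β _ γ hγ ih =>
      obtain ⟨i, rfl⟩ := hγ
      rw [hgen, ih]
    | mul_inv_cancel β _ γ hγ ih =>
      obtain ⟨i, rfl⟩ := hγ
      have := hgen (β * (halvingGens n ϱ i)⁻¹) i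
      rw [inv_mul_cancel_right] at this
      rw [← this, ih]
  intro hmem_r
  have := hflip 1
  rw [one_mul] at this
  exact this (hmem r hmem_r)

/-- If the last distinguished generator of a regular polytope is not in the halving group, then the
facet graph is bipartite. -/
theorem IsDistinguishedGens.bipartite_of_notMem_halving (hn : 2 ≤ n) (hP : IsPolytope P rk n)
    (hreg : IsRegularPolytope P) (hϱ : IsDistinguishedGens P rk n Φ ϱ)
    (hr : ϱ ⟨n - 1, by omega⟩ ∉ Subgroup.closure (Set.range (halvingGens n ϱ))) :
    FacetGraphBipartite P rk n := by
  classical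
  obtain ⟨F₀, hF₀, hrF₀⟩ := hϱ.1.exists_rk_eq hP (k := (n : ℤ) - 1) (by omega) (by omega)
  obtain ⟨E₀, hE₀, hrE₀⟩ := hϱ.1.exists_rk_eq hP (k := (n : ℤ) - 2) (by omega) (by omega)
  have hEF₀ : E₀ ≤ F₀ := (hϱ.1.lt_of_rk_lt hP hE₀ hF₀ (by omega)).le
  set H := Subgroup.closure (Set.range (halvingGens n ϱ))
  have hor := hϱ.mem_halving_or hn hP
  set r := ϱ ⟨n - 1, by omega⟩
  have hrE : r.1 E₀ = E₀ := hϱ.apply_eq hP hE₀ (by simp only [ne_eq]; omega)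
  have hrF : r.1 F₀ ≠ F₀ := hϱ.apply_ne hP hF₀ (by simp only; omega)
  have hiff : ∀ α : orderAut P, (∃ h ∈ H, h.1 F₀ = α.1 F₀) ↔ α ∈ H := by
    refine fun α => ⟨?_, fun h => ⟨α, h, rfl⟩⟩
    rintro ⟨h, hh, hα⟩
    refine (H.mul_mem_cancel_left (H.inv_mem hh)).1 (hϱ.mem_halving_of_apply_eq hP hF₀ hrF₀ ?_)
    change h⁻¹.1 (α.1 F₀) = F₀
    rw [← hα]
    simp
  refine ⟨fun F => decide (∃ h ∈ H, h.1 F₀ = F), ?_⟩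
  rintro F F' hrF₁ hrF' hne ⟨E, hrE₁, hEF, hEF'⟩
  obtain ⟨A, hA, hEA, hFA⟩ := exists_isMaxFlag_of_le hEF
  obtain ⟨α, hα, hαA⟩ := hreg Φ A hϱ.1 hA
  lift α to orderAut P using hα
  have hαF : α.1 F₀ = F := hA.eq_of_rk_eq hP (hαA ▸ Set.mem_image_of_mem _ hF₀) hFA
    (by rw [hP.rk_orderAut]; omega)
  have hαE : α.1 E₀ = E := hA.eq_of_rk_eq hP (hαA ▸ Set.mem_image_of_mem _ hE₀) hEA
    (by rw [hP.rk_orderAut]; omega)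
  have hαF' : (α * r).1 F₀ = F' := by
    change α.1 (r.1 F₀) = F'
    refine hP.facet_eq_of_ridge_le hrE₁ hrF₁ ?_ hrF' hEF ?_ hEF' ?_ hne.symm
    · simpa only [hP.rk_orderAut] using hrF₀
    · rw [← hαE, α.2, ← hrE, r.2]
      exact hEF₀
    · rw [← hαF]
      exact fun h => hrF (α.1.injective h)
  simp only [← hαF', ← hαF, hiff, ne_eq, decide_eq_decide]
  intro h
  rcases hor α with h' | h'
  · exact hr ((H.mul_mem_cancel_left h').1 (h.1 h'))
  · exact hr ((H.mul_mem_cancel_left (h.2 h')).1 h')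

end Flags

theorem Subgroup.even_orderOf_of_index_eq_two {G : Type*} [Group G] {H : Subgroup G}
    (hH : H.index = 2) {g : G} (hg : g ∉ H) : Even (orderOf g) := by
  by_contra hodd
  obtain ⟨k, hk⟩ := Nat.not_even_iff_odd.1 hodd
  have h := pow_orderOf_eq_one g
  rw [hk, pow_succ, pow_mul] at h
  exact hg ((H.mul_mem_cancel_left (H.pow_mem (H.sq_mem_of_index_two hH g) k)).1
    (h ▸ H.one_mem))

/-- the halving group `H(P)` has index exactly `2` in
`Aut(P)` if and only if the facet graph of `P` is bipartite; in particular
this is possible only if `p_{n-1}` (the order of `ϱ_{n-2}ϱ_{n-1}`) is even. -/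
theorem halvingGroup_index_eq_two_iff {P : Type*} [PartialOrder P]
    (rk : P → ℤ) (n : ℕ) (hn : 3 ≤ n)
    (hP : IsPolytope P rk n) (hnd : NonDegenerate P rk)
    (hreg : IsRegularPolytope P)
    (Φ : Set P) (ϱ : Fin n → ↥(orderAut P))
    (hϱ : IsDistinguishedGens P rk n Φ ϱ) :
    ((Subgroup.closure (Set.range (halvingGens n ϱ))).index = 2 ↔
      FacetGraphBipartite P rk n) ∧
    ((Subgroup.closure (Set.range (halvingGens n ϱ))).index = 2 →
      Even (orderOf (ϱ ⟨n - 2, by omega⟩ * ϱ ⟨n - 1, by omega⟩))) := by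
  have hindex := hϱ.index_halving_eq_two_iff (by omega) hP
  refine ⟨hindex.trans ⟨hϱ.bipartite_of_notMem_halving (by omega) hP hreg,
    hϱ.notMem_halving_of_bipartite (by omega) hP⟩, fun h => ?_⟩
  refine Subgroup.even_orderOf_of_index_eq_two h fun hmem => hindex.1 h ?_
  exact (Subgroup.mul_mem_cancel_left _
    (mem_halving_of_ne ϱ (by simp only [ne_eq]; omega))).1 hmem
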